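/- Consider the natural conformal operator family on A (the case b = 0): 𝔉₀ = {A_{i,j}, B_{r,s}, C_{r,s} (1 ≤ i,j ≤ n, 1 ≤ r < s ≤ n), K_k (1 ≤ k ≤ 2n), ∂_k (0 ≤ k ≤ 2n), D, J_k (0 ≤ k ≤ 2n)}. Then every operator in 𝔉₀ maps the subspace ℂ·1 of constant polynomials to 0 (so ℂ·1 is a trivial submodule), and the only ℂ-subspaces of A invariant under every operator in 𝔉₀ are 0, ℂ·1, and A; in particular, the quotient A/ℂ·1 has no invariant subspace other than 0 and the whole quotient. -/

import Mathlib

open MvPolynomial Matrix LinearMap TensorProduct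

noncomputable section

variable (n : ℕ)

/-- The polynomial algebra `ℂ[x_0,x_1,…,x_{2n}]`, indices in `Fin (n+n+1)`:
`0 ↔ x_0`, `(Fin.castAdd n i).succ ↔ x_{i+1}` and `(Fin.natAdd n i).succ ↔ x_{n+i+1}`. -/
abbrev PB : Type := MvPolynomial (Fin (n + n + 1)) ℂ

/-- Partial derivative `∂_i` as a linear endomorphism. -/
def pd (i : Fin (n + n + 1)) : Module.End ℂ (PB n) := (pderiv i).toLinearMap

/-- Multiplication by a polynomial, as a linear endomorphism. -/
def mX (f : PB n) : Module.End ℂ (PB n) := LinearMap.mulLeft ℂ f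

/-- Index of `x_i` (`1 ≤ i ≤ n`). -/
def jL (i : Fin n) : Fin (n + n + 1) := (Fin.castAdd n i).succ
/-- Index of `x_{n+i}` (`1 ≤ i ≤ n`). -/
def jR (i : Fin n) : Fin (n + n + 1) := (Fin.natAdd n i).succ

/-- `η = x_0²/2 + Σ x_i x_{n+i}`. -/
def eta : PB n :=
  MvPolynomial.C (2⁻¹ : ℂ) * (X (0 : Fin (n + n + 1)) * X 0) + ∑ i : Fin n, X (jL n i) * X (jR n i)

/-- The degree operator `D = Σ x_r ∂_r`. -/
def Dop : Module.End ℂ (PB n) := ∑ r : Fin (n + n + 1), mX n (X r) * pd n r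

/-- The involution fixing `0` and swapping `i ↔ n+i`. -/
def sw (k : Fin (n + n + 1)) : Fin (n + n + 1) :=
  Fin.cases 0 (fun j => (finSumFinEquiv (Sum.swap (finSumFinEquiv.symm j))).succ) k

/-- `J_k = x_k D − η ∂_{sw k}` (in particular `J_0 = x_0 D − η∂_0`). -/
def Jop (k : Fin (n + n + 1)) : Module.End ℂ (PB n) :=
  mX n (X k) * Dop n - mX n (eta n) * pd n (sw n k)

/-- `K_i = x_0∂_i − x_{n+i}∂_0` and `K_{n+i} = x_0∂_{n+i} − x_i∂_0`, indexed by `Fin (n+n)`. -/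
def Kop (k : Fin (n + n)) : Module.End ℂ (PB n) :=
  mX n (X (0 : Fin (n + n + 1))) * pd n k.succ - mX n (X (sw n k.succ)) * pd n 0

/-- `A_{i,j} = x_i∂_j − x_{n+j}∂_{n+i}`. -/
def Aop (i j : Fin n) : Module.End ℂ (PB n) :=
  mX n (X (jL n i)) * pd n (jL n j) - mX n (X (jR n j)) * pd n (jR n i)

/-- `B_{i,j} = x_i∂_{n+j} − x_j∂_{n+i}`. -/
def Bop (i j : Fin n) : Module.End ℂ (PB n) :=
  mX n (X (jL n i)) * pd n (jR n j) - mX n (X (jL n j)) * pd n (jR n i)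

/-- `C_{i,j} = x_{n+i}∂_j − x_{n+j}∂_i`. -/
def Cop (i j : Fin n) : Module.End ℂ (PB n) :=
  mX n (X (jR n i)) * pd n (jL n j) - mX n (X (jR n j)) * pd n (jL n i)

@[simp]
lemma pd_apply (i : Fin (n + n + 1)) (f : PB n) : pd n i f = pderiv i f := rfl

@[simp]
lemma mX_apply (f g : PB n) : mX n f g = f * g := rfl

lemma Dop_apply (f : PB n) : Dop n f = ∑ r, X r * pderiv r f := by
  simp [Dop, LinearMap.sum_apply]

lemma Jop_apply (k : Fin (n + n + 1)) (f : PB n) :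
    Jop n k f = X k * Dop n f - eta n * pderiv (sw n k) f := by
  simp [Jop]

lemma Kop_apply (k : Fin (n + n)) (f : PB n) :
    Kop n k f = X 0 * pderiv k.succ f - X (sw n k.succ) * pderiv 0 f := by
  simp [Kop]

@[simp]
lemma sw_zero : sw n 0 = 0 := rfl

@[simp]
lemma sw_jL (i : Fin n) : sw n (jL n i) = jR n i := by
  simp [sw, jL, jR]

@[simp]
lemma sw_jR (i : Fin n) : sw n (jR n i) = jL n i := by
  simp [sw, jL, jR, -Fin.natAdd_eq_addNat]

@[elab_as_elim]
lemma index_cases {motive : Fin (n + n + 1) → Prop} (zero : motive 0)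
    (left : ∀ i, motive (jL n i)) (right : ∀ i, motive (jR n i)) (k : Fin (n + n + 1)) :
    motive k := by
  refine Fin.cases zero (fun j => ?_) k
  exact Fin.addCases left right j

lemma sw_sw (k : Fin (n + n + 1)) : sw n (sw n k) = k := by
  induction k using index_cases <;> simp

lemma sw_succ_ne_zero (k : Fin (n + n)) : sw n k.succ ≠ 0 := by
  intro h
  have := congrArg (sw n) h
  rw [sw_sw, sw_zero] at this
  exact Fin.succ_ne_zero k this

lemma sw_succ_ne (k : Fin (n + n)) : sw n k.succ ≠ k.succ := by
  refine Fin.addCases (fun i => ?_) (fun i => ?_) k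
  · change sw n (jL n i) ≠ jL n i
    rw [sw_jL]
    have := i.isLt
    simp only [jL, jR, ne_eq, Fin.ext_iff, Fin.val_succ, Fin.val_castAdd, Fin.val_natAdd]
    omega
  · change sw n (jR n i) ≠ jR n i
    rw [sw_jR]
    have := i.isLt
    simp only [jL, jR, ne_eq, Fin.ext_iff, Fin.val_succ, Fin.val_castAdd, Fin.val_natAdd]
    omega

lemma sum_X_mul_X_sw :
    ∑ k : Fin (n + n + 1), (X k * X (sw n k) : PB n) = 2 * eta n := by
  have hC : (2 : PB n) * C (2⁻¹ : ℂ) = 1 := by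
    rw [← map_ofNat (C : ℂ →+* PB n) 2, ← C_mul]
    norm_num
  rw [Fin.sum_univ_succ, Fin.sum_univ_add, sw_zero]
  change X 0 * X 0 + (∑ i, X (jL n i) * X (sw n (jL n i)) +
    ∑ i, X (jR n i) * X (sw n (jR n i))) = _
  simp only [sw_jL, sw_jR, mul_comm (X (jR n _) : PB n), eta]
  linear_combination (-(X 0 * X 0) : PB n) * hC

lemma pderiv_eta (j : Fin (n + n + 1)) : pderiv j (eta n) = X (sw n j) := by
  have h := congrArg (pderiv j) (sum_X_mul_X_sw n)
  have hsw : ∀ k, (sw n k = j) ↔ (k = sw n j) := fun k =>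
    ⟨fun h => by rw [← h, sw_sw], fun h => by rw [h, sw_sw]⟩
  have h2 : pderiv j (2 * eta n) = 2 * pderiv j (eta n) := by
    rw [two_mul, map_add, two_mul]
  rw [h2, map_sum] at h
  simp only [pderiv_mul, pderiv_X, Pi.single_apply, Finset.sum_add_distrib, ite_mul, mul_ite,
    one_mul, zero_mul, mul_one, mul_zero, hsw] at h
  simp only [Finset.sum_ite_eq', Finset.mem_univ, if_true] at h
  have h0 : (2 : PB n) ≠ 0 := two_ne_zero
  apply mul_left_cancel₀ h0
  rw [← h, two_mul]

lemma eta_isHomogeneous : (eta n).IsHomogeneous 2 := by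
  refine IsHomogeneous.add ?_ (IsHomogeneous.sum _ _ _ fun i _ => ?_)
  · simpa using (isHomogeneous_C _ (2⁻¹ : ℂ)).mul
      ((isHomogeneous_X ℂ (0 : Fin (n + n + 1))).mul (isHomogeneous_X ℂ 0))
  · exact (isHomogeneous_X ℂ _).mul (isHomogeneous_X ℂ _)

lemma Dop_of_isHomogeneous {f : PB n} {d : ℕ} (hf : f.IsHomogeneous d) :
    Dop n f = (d : PB n) * f := by
  rw [Dop_apply, hf.sum_X_mul_pderiv, nsmul_eq_mul]

lemma Jop_eta_pow_mul (k : Fin (n + n + 1)) (i : ℕ) {g : PB n} {e : ℕ}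
    (hg : g.IsHomogeneous e) :
    Jop n k (eta n ^ i * g) = ((i + e : ℕ) : PB n) * (eta n ^ i * (X k * g)) -
      eta n ^ (i + 1) * pderiv (sw n k) g := by
  have hD : Dop n (eta n ^ i * g) = ((2 * i + e : ℕ) : PB n) * (eta n ^ i * g) :=
    Dop_of_isHomogeneous n (((eta_isHomogeneous n).pow i).mul hg)
  rw [Jop_apply, hD, pderiv_mul, pderiv_pow, pderiv_eta, sw_sw]
  rcases i with _ | i
  · simp
    ring
  · push_cast
    ring

/-- `∑ₖ Jₖ(ηⁱ x_{sw k}) = (2(i+1) - (2n+1)) ηⁱ⁺¹`. -/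
lemma sum_Jop_eta_pow_mul_X_sw (i : ℕ) :
    ∑ k, Jop n k (eta n ^ i * X (sw n k)) =
      (2 * (i + 1) - (2 * n + 1) : ℂ) • eta n ^ (i + 1) := by
  have h : ∀ k, Jop n k (eta n ^ i * X (sw n k)) =
      ((i + 1 : ℕ) : PB n) * eta n ^ i * (X k * X (sw n k)) - eta n ^ (i + 1) := by
    intro k
    rw [Jop_eta_pow_mul n k i (isHomogeneous_X ℂ _), pderiv_X_self]
    ring
  simp only [h, Finset.sum_sub_distrib, ← Finset.mul_sum, sum_X_mul_X_sw, Finset.sum_const,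
    Finset.card_univ, Fintype.card_fin, smul_eq_C_mul, nsmul_eq_mul]
  have h2 : (C (2 : ℂ) : PB n) = 2 := map_ofNat C 2
  simp only [C_sub, C_add, C_mul, h2, C_1, map_natCast]
  push_cast
  ring

variable {n}

lemma mem_of_natCast_mul_mem {W : Submodule ℂ (PB n)} {d : ℕ} (hd : d ≠ 0) {f : PB n}
    (hf : (d : PB n) * f ∈ W) : f ∈ W := by
  have h0 : (d : ℂ) ≠ 0 := Nat.cast_ne_zero.mpr hd
  have : (d : ℂ) • f ∈ W := by rwa [smul_eq_C_mul, map_natCast]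
  exact (W.smul_mem_iff h0).mp this

/-- If `W` contains all forms of degree `d - 1 ≥ 1`, it contains every form `ηⁱ g` of
degree `d`; the induction is on `m = deg g`. -/
lemma eta_pow_mul_mem {W : Submodule ℂ (PB n)}
    (hJ : ∀ k : Fin (n + n + 1), ∀ f ∈ W, Jop n k f ∈ W) {d : ℕ} (hd : 1 ≤ d)
    (hW : ∀ f : PB n, f.IsHomogeneous d → f ∈ W) (m : ℕ) :
    ∀ (i : ℕ) (g : PB n), 2 * i + m = d + 1 → g.IsHomogeneous m → eta n ^ i * g ∈ W := by
  induction m using Nat.strong_induction_on with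
  | _ m ih =>
  intro i g hi hg
  rcases m with _ | m
  · obtain ⟨j, rfl⟩ : ∃ j, i = j + 1 := ⟨i - 1, by omega⟩
    have hsum : ∑ k, Jop n k (eta n ^ j * X (sw n k)) ∈ W := by
      refine W.sum_mem fun k _ => hJ k _ (hW _ ?_)
      have := ((eta_isHomogeneous n).pow j).mul (isHomogeneous_X ℂ (sw n k))
      rwa [show 2 * j + 1 = d by omega] at this
    rw [sum_Jop_eta_pow_mul_X_sw] at hsum
    have h0 : (2 * (j + 1) - (2 * n + 1) : ℂ) ≠ 0 := by
      intro h
      have h' : ((2 * (j + 1) : ℕ) : ℂ) = ((2 * n + 1 : ℕ) : ℂ) := by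
        push_cast
        linear_combination h
      have := Nat.cast_injective h'
      omega
    rw [← totalDegree_zero_iff_isHomogeneous, totalDegree_eq_zero_iff_eq_C] at hg
    rw [hg, mul_comm, ← smul_eq_C_mul]
    exact W.smul_mem _ ((W.smul_mem_iff h0).mp hsum)
  · have hX : ∀ (k : Fin (n + n + 1)) (p : PB n), p.IsHomogeneous m →
        eta n ^ i * (X k * p) ∈ W := by
      intro k p hp
      have hmem : Jop n k (eta n ^ i * p) ∈ W := by
        refine hJ k _ (hW _ ?_)
        have := ((eta_isHomogeneous n).pow i).mul hp
        rwa [show 2 * i + m = d by omega] at this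
      have hder : eta n ^ (i + 1) * pderiv (sw n k) p ∈ W := by
        rcases m with _ | m
        · rw [← totalDegree_zero_iff_isHomogeneous, totalDegree_eq_zero_iff_eq_C] at hp
          rw [hp, pderiv_C, mul_zero]
          exact W.zero_mem
        · exact ih m (by omega) (i + 1) _ (by omega) hp.pderiv
      rw [Jop_eta_pow_mul n k i hp] at hmem
      have := W.add_mem hmem hder
      rw [sub_add_cancel] at this
      exact mem_of_natCast_mul_mem (by omega) this
    refine mem_of_natCast_mul_mem (Nat.succ_ne_zero m) ?_
    have hE := hg.sum_X_mul_pderiv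
    rw [nsmul_eq_mul] at hE
    rw [mul_left_comm, Nat.succ_eq_add_one, ← hE, Finset.mul_sum]
    exact W.sum_mem fun k _ => hX k _ hg.pderiv

lemma eq_top_of_X_mem {W : Submodule ℂ (PB n)}
    (hpd : ∀ k : Fin (n + n + 1), ∀ f ∈ W, pd n k f ∈ W)
    (hJ : ∀ k : Fin (n + n + 1), ∀ f ∈ W, Jop n k f ∈ W)
    (hX : ∀ k : Fin (n + n + 1), (X k : PB n) ∈ W) : W = ⊤ := by
  have hC : ∀ f : PB n, f.IsHomogeneous 0 → f ∈ W := by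
    intro f hf
    rw [← totalDegree_zero_iff_isHomogeneous, totalDegree_eq_zero_iff_eq_C] at hf
    have h1 := hpd 0 _ (hX 0)
    rw [pd_apply, pderiv_X_self] at h1
    rw [hf, ← mul_one (C _), ← smul_eq_C_mul]
    exact W.smul_mem _ h1
  have hpos : ∀ d : ℕ, ∀ f : PB n, f.IsHomogeneous (d + 1) → f ∈ W := by
    intro d
    induction d with
    | zero =>
      intro f hf
      have hE := hf.sum_X_mul_pderiv
      rw [zero_add, one_smul] at hE
      rw [← hE]
      refine W.sum_mem fun k _ => ?_
      have h0 : (pderiv k f).IsHomogeneous 0 := hf.pderiv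
      rw [← totalDegree_zero_iff_isHomogeneous, totalDegree_eq_zero_iff_eq_C] at h0
      rw [h0, mul_comm, ← smul_eq_C_mul]
      exact W.smul_mem _ (hX k)
    | succ d ih =>
      intro f hf
      simpa using eta_pow_mul_mem hJ (Nat.succ_pos d) ih (d + 2) 0 f (by omega) hf
  refine eq_top_iff.mpr fun f _ => ?_
  rw [← sum_homogeneousComponent f]
  refine W.sum_mem fun d _ => ?_
  rcases d with _ | d
  · exact hC _ (homogeneousComponent_isHomogeneous _ _)
  · exact hpos d _ (homogeneousComponent_isHomogeneous _ _)

lemma totalDegree_pderiv_lt {σ R : Type*} [CommSemiring R] {f : MvPolynomial σ R}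
    (hf : f.totalDegree ≠ 0) (i : σ) : (pderiv i f).totalDegree < f.totalDegree := by
  classical
  rw [totalDegree, Finset.sup_lt_iff (Nat.pos_of_ne_zero hf)]
  intro m hm
  rw [mem_support_iff, coeff_pderiv] at hm
  have hmem : m + Finsupp.single i 1 ∈ f.support := by
    rw [mem_support_iff]
    intro h
    simp [h] at hm
  have := le_totalDegree hmem
  rw [Finsupp.sum_add_index' (by simp) (by simp), Finsupp.sum_single_index rfl] at this
  omega

lemma eq_C_of_pderiv_eq_zero {σ R : Type*} [CommRing R] [IsDomain R] [CharZero R]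
    {f : MvPolynomial σ R} (hf : ∀ i, pderiv i f = 0) : f = C (coeff 0 f) := by
  classical
  ext m
  rw [coeff_C]
  split_ifs with h
  · rw [h]
  · obtain ⟨i, hi⟩ := Finsupp.ne_iff.mp (Ne.symm h)
    have hle : Finsupp.single i 1 ≤ m := by
      rw [Finsupp.single_le_iff]
      exact Nat.one_le_iff_ne_zero.mpr hi
    have := congrArg (coeff (m - Finsupp.single i 1)) (hf i)
    rw [coeff_pderiv, tsub_add_cancel_of_le hle, coeff_zero] at this
    refine (mul_eq_zero.mp this).resolve_right ?_
    exact Nat.cast_add_one_ne_zero _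

lemma exists_pderiv_eq_C {W : Submodule ℂ (PB n)}
    (hpd : ∀ k : Fin (n + n + 1), ∀ f ∈ W, pd n k f ∈ W) (d : ℕ) :
    ∀ f ∈ W, f.totalDegree = d → d ≠ 0 →
      ∃ g ∈ W, ∃ a : Fin (n + n + 1) → ℂ, a ≠ 0 ∧ ∀ k, pderiv k g = C (a k) := by
  induction d using Nat.strong_induction_on with
  | _ d ih =>
  intro f hf hfd hd
  by_cases h : ∃ k, (pderiv k f).totalDegree ≠ 0
  · obtain ⟨k, hk⟩ := h
    exact ih _ (hfd ▸ totalDegree_pderiv_lt (hfd.trans_ne hd) k) _ (hpd k f hf) rfl hk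
  · push Not at h
    refine ⟨f, hf, fun k => coeff 0 (pderiv k f), fun h0 => hd ?_,
      fun k => totalDegree_eq_zero_iff_eq_C.mp (h k)⟩
    rw [← hfd, totalDegree_eq_zero_iff_eq_C]
    refine eq_C_of_pderiv_eq_zero fun k => ?_
    rw [totalDegree_eq_zero_iff_eq_C.mp (h k), show coeff 0 (pderiv k f) = 0 from congrFun h0 k,
      C_0]

lemma X_mem_of_X_zero_mem {W : Submodule ℂ (PB n)}
    (hK : ∀ k : Fin (n + n), ∀ f ∈ W, Kop n k f ∈ W) (h0 : (X 0 : PB n) ∈ W)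
    (k : Fin (n + n + 1)) : (X k : PB n) ∈ W := by
  have hsw : ∀ k : Fin (n + n + 1), (X (sw n k) : PB n) ∈ W := by
    intro k
    refine Fin.cases (by simpa using h0) (fun j => ?_) k
    have := hK j _ h0
    rw [Kop_apply, pderiv_X_self, pderiv_X_of_ne (Fin.succ_ne_zero j).symm] at this
    simpa using this
  simpa [sw_sw] using hsw (sw n k)

lemma X_zero_mem_of_X_mem {W : Submodule ℂ (PB n)}
    (hK : ∀ k : Fin (n + n), ∀ f ∈ W, Kop n k f ∈ W) (k : Fin (n + n + 1))
    (hk : (X k : PB n) ∈ W) : (X 0 : PB n) ∈ W := by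
  cases k using Fin.cases with
  | zero => exact hk
  | succ j =>
    have := hK j _ hk
    rw [Kop_apply, pderiv_X_self, pderiv_X_of_ne (Fin.succ_ne_zero j)] at this
    simpa using this

lemma X_zero_mem_of_linear_mem {W : Submodule ℂ (PB n)}
    (hK : ∀ k : Fin (n + n), ∀ f ∈ W, Kop n k f ∈ W)
    (hD : ∀ f ∈ W, Dop n f ∈ W) {g : PB n} (hg : g ∈ W)
    {a : Fin (n + n + 1) → ℂ} (ha : a ≠ 0) (hga : ∀ k, pderiv k g = C (a k)) :
    (X 0 : PB n) ∈ W := by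
  by_cases h : ∃ k : Fin (n + n), a k.succ ≠ 0
  · obtain ⟨k, hk⟩ := h
    have hKK := hK k _ (hK k g hg)
    have hval : Kop n k (Kop n k g) = (-a k.succ) • X (sw n k.succ) := by
      simp only [Kop_apply, hga, map_sub, pderiv_mul, pderiv_C, pderiv_X_self,
        pderiv_X_of_ne (Fin.succ_ne_zero k).symm, pderiv_X_of_ne (sw_succ_ne n k),
        pderiv_X_of_ne (sw_succ_ne_zero n k), smul_eq_C_mul, C_neg]
      ring
    rw [hval, W.smul_mem_iff (neg_ne_zero.mpr hk)] at hKK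
    exact X_zero_mem_of_X_mem hK _ hKK
  · push Not at h
    have h0 : a 0 ≠ 0 := by
      refine fun h0 => ha (funext fun k => ?_)
      exact Fin.cases h0 h k
    have hDg := hD g hg
    simp only [Dop_apply, hga, Fin.sum_univ_succ, h, C_0, mul_zero, Finset.sum_const_zero,
      add_zero] at hDg
    rw [mul_comm, ← smul_eq_C_mul, W.smul_mem_iff h0] at hDg
    exact hDg

lemma eq_bot_or_span_one_or_top {W : Submodule ℂ (PB n)}
    (hK : ∀ k : Fin (n + n), ∀ f ∈ W, Kop n k f ∈ W)
    (hpd : ∀ k : Fin (n + n + 1), ∀ f ∈ W, pd n k f ∈ W)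
    (hD : ∀ f ∈ W, Dop n f ∈ W)
    (hJ : ∀ k : Fin (n + n + 1), ∀ f ∈ W, Jop n k f ∈ W) :
    W = ⊥ ∨ W = Submodule.span ℂ {(1 : PB n)} ∨ W = ⊤ := by
  by_cases h : ∃ f ∈ W, f.totalDegree ≠ 0
  · obtain ⟨f, hf, hf0⟩ := h
    obtain ⟨g, hg, a, ha, hga⟩ := exists_pderiv_eq_C hpd _ f hf rfl hf0
    exact .inr (.inr (eq_top_of_X_mem hpd hJ
      (X_mem_of_X_zero_mem hK (X_zero_mem_of_linear_mem hK hD hg ha hga))))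
  · push Not at h
    have hle : W ≤ Submodule.span ℂ {(1 : PB n)} := fun f hf => by
      rw [Submodule.mem_span_singleton]
      exact ⟨coeff 0 f, by
        rw [smul_eq_C_mul, mul_one, ← totalDegree_eq_zero_iff_eq_C.mp (h f hf)]⟩
    have hatom : IsAtom (Submodule.span ℂ {(1 : PB n)}) :=
      nonzero_span_atom _ one_ne_zero
    rcases hatom.le_iff.mp hle with h | h
    · exact .inl h
    · exact .inr (.inl h)

variable (n)

/-- **Theorem 3.7, second part.**  For the natural conformal action (`b = 0`) on
`A = ℂ[x_0,x_1,…,x_{2n}]`: all operators kill the constants, and the invariant subspaces are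
exactly `0`, `ℂ·1` and `A`; consequently the invariant subspaces containing `ℂ·1` are only
`ℂ·1` and `A` (irreducibility of the quotient `A/ℂ·1`). -/
theorem statement9 (hn : 1 ≤ n) :
    (∀ c : ℂ,
      (∀ i j : Fin n, Aop n i j (MvPolynomial.C c) = 0) ∧
      (∀ r t : Fin n, r < t → Bop n r t (MvPolynomial.C c) = 0) ∧
      (∀ r t : Fin n, r < t → Cop n r t (MvPolynomial.C c) = 0) ∧
      (∀ k : Fin (n + n), Kop n k (MvPolynomial.C c) = 0) ∧
      (∀ k : Fin (n + n + 1), pd n k (MvPolynomial.C c) = 0) ∧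
      Dop n (MvPolynomial.C c) = 0 ∧
      (∀ k : Fin (n + n + 1), Jop n k (MvPolynomial.C c) = 0)) ∧
    (∀ W : Submodule ℂ (PB n),
      (∀ i j : Fin n, ∀ f ∈ W, Aop n i j f ∈ W) →
      (∀ r t : Fin n, r < t → ∀ f ∈ W, Bop n r t f ∈ W) →
      (∀ r t : Fin n, r < t → ∀ f ∈ W, Cop n r t f ∈ W) →
      (∀ k : Fin (n + n), ∀ f ∈ W, Kop n k f ∈ W) →
      (∀ k : Fin (n + n + 1), ∀ f ∈ W, pd n k f ∈ W) →
      (∀ f ∈ W, Dop n f ∈ W) →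
      (∀ k : Fin (n + n + 1), ∀ f ∈ W, Jop n k f ∈ W) →
      W = ⊥ ∨ W = Submodule.span ℂ {(1 : PB n)} ∨ W = ⊤) ∧
    (∀ W : Submodule ℂ (PB n), Submodule.span ℂ {(1 : PB n)} ≤ W →
      (∀ i j : Fin n, ∀ f ∈ W, Aop n i j f ∈ W) →
      (∀ r t : Fin n, r < t → ∀ f ∈ W, Bop n r t f ∈ W) →
      (∀ r t : Fin n, r < t → ∀ f ∈ W, Cop n r t f ∈ W) →
      (∀ k : Fin (n + n), ∀ f ∈ W, Kop n k f ∈ W) →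
      (∀ k : Fin (n + n + 1), ∀ f ∈ W, pd n k f ∈ W) →
      (∀ f ∈ W, Dop n f ∈ W) →
      (∀ k : Fin (n + n + 1), ∀ f ∈ W, Jop n k f ∈ W) →
      W = Submodule.span ℂ {(1 : PB n)} ∨ W = ⊤) := by
  refine ⟨fun c => ?_, fun W _ _ _ hK hpd hD hJ => eq_bot_or_span_one_or_top hK hpd hD hJ,
    fun W hW _ _ _ hK hpd hD hJ => ?_⟩
  · simp [Aop, Bop, Cop, Kop_apply, Dop_apply, Jop_apply]
  · refine (eq_bot_or_span_one_or_top hK hpd hD hJ).resolve_left ?_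
    rintro rfl
    simp at hW
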